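/- Let d ≥ 2 and let Φ be a symmetric linear GDMS associated to F_d with multiplicative symmetric weight c_Φ. Then for every non-trivial normal subgroup N of F_d, the exponent of convergence satisfies δ(N,Φ) ≥ δ(F_d,Φ)/2. -/

import Mathlib

/-- The weight of a free-group element with respect to symmetric contraction ratios
`r i` on the generators: the product of the ratios over the letters of the reduced word. -/
noncomputable def cWeight {d : ℕ} (r : Fin d → ℝ) (g : FreeGroup (Fin d)) : ℝ :=
  ((FreeGroup.toWord g).map (fun p => r p.1)).prod

/-- The exponent of convergence of a subgroup `H` with respect to the weight `cWeight r`. -/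
noncomputable def expConv {d : ℕ} (r : Fin d → ℝ) (H : Subgroup (FreeGroup (Fin d))) : ℝ :=
  sInf {t : ℝ | 0 ≤ t ∧ Summable (fun h : H => cWeight r (h : FreeGroup (Fin d)) ^ t)}

theorem exists_letter {d : ℕ} (hd : 2 ≤ d) (L w : List (Fin d × Bool)) (hL : FreeGroup.IsReduced L)
    (hw : FreeGroup.IsReduced w) (hne : w ≠ []) :
    ∃ s : Fin d × Bool,
      FreeGroup.IsReduced ((L ++ [s]) ++ w ++ FreeGroup.invRev (L ++ [s])) := by
  classical
  obtain ⟨s, hs⟩ : ∃ s : Fin d × Bool,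
      s ∉ ({((w.head hne).1, !(w.head hne).2), w.getLast hne,
        ((L.getLastD (w.head hne)).1, !(L.getLastD (w.head hne)).2)} : Finset (Fin d × Bool)) := by
    by_contra! h
    have h1 := Finset.card_le_card (fun x _ => h x : (Finset.univ : Finset (Fin d × Bool)) ⊆ _)
    have h2 := h1.trans Finset.card_le_three
    simp at h2
    omega
  simp only [Finset.mem_insert, Finset.mem_singleton, not_or] at hs
  obtain ⟨s1, s2, s3⟩ := hs
  refine ⟨s, ?_⟩
  have key : ∀ a b : Fin d × Bool, b ≠ (a.1, !a.2) → a.1 = b.1 → a.2 = b.2 := by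
    rintro ⟨a, p⟩ ⟨b, q⟩ h1 h2
    simp only at h2
    subst h2
    cases p <;> cases q <;> simp_all
  have c1 : FreeGroup.IsReduced (L ++ [s]) := by
    refine List.IsChain.append hL (List.isChain_singleton s) ?_
    intro x hx y hy
    simp only [List.head?_cons, Option.mem_def, Option.some.injEq] at hy
    subst hy
    apply key
    have : L.getLastD (w.head hne) = x := by
      rw [List.getLastD_eq_getLast?, Option.mem_def.1 hx]; rfl
    rwa [this] at s3
  have c2 : FreeGroup.IsReduced (FreeGroup.invRev (L ++ [s])) := by
    rw [FreeGroup.isReduced_iff_reduce_eq, FreeGroup.reduce_invRev, c1.reduce_eq]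
  have c3 : FreeGroup.IsReduced ((L ++ [s]) ++ w) := by
    refine List.IsChain.append c1 hw ?_
    intro x hx y hy
    simp only [List.getLast?_append, List.getLast?_singleton, Option.some_or, Option.mem_def,
      Option.some.injEq] at hx
    subst hx
    rw [List.head?_eq_some_head hne] at hy
    simp only [Option.mem_def, Option.some.injEq] at hy
    subst hy
    intro h
    exact (key _ _ s1 h.symm).symm
  refine List.IsChain.append c3 c2 ?_
  intro x hx y hy
  rw [List.getLast?_append_of_ne_nil _ hne, List.getLast?_eq_some_getLast hne] at hx
  simp only [Option.mem_def, Option.some.injEq] at hx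
  subst hx
  simp [FreeGroup.invRev] at hy
  subst hy
  apply key
  intro h
  apply s2
  rw [Prod.ext_iff] at h ⊢
  simpa using h

theorem summable_top {d : ℕ} (hd : 2 ≤ d) (r : Fin d → ℝ) (hr : ∀ i, 0 < r i ∧ r i < 1)
    (N : Subgroup (FreeGroup (Fin d))) [hNn : N.Normal] (hN : N ≠ ⊥) (t : ℝ) (ht : 0 ≤ t)
    (hs : Summable (fun h : N => cWeight r (h : FreeGroup (Fin d)) ^ t)) :
    Summable (fun h : (⊤ : Subgroup (FreeGroup (Fin d))) =>
      cWeight r (h : FreeGroup (Fin d)) ^ (2 * t)) := by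
  obtain ⟨n, hnN, hn1⟩ := (Subgroup.ne_bot_iff_exists_ne_one.1 hN : ∃ a : N, a ≠ 1) |>.elim
    (fun a ha => (⟨a, a.2, fun h => ha (Subtype.ext h)⟩ :
      ∃ n : FreeGroup (Fin d), n ∈ N ∧ n ≠ 1))
  have hpos : ∀ L : List (Fin d × Bool), 0 < (L.map (fun p => r p.1)).prod := by
    intro L
    apply List.prod_pos
    intro a ha
    obtain ⟨p, _, rfl⟩ := List.mem_map.1 ha
    exact (hr p.1).1
  have hinv : ∀ L : List (Fin d × Bool), ((FreeGroup.invRev L).map (fun p => r p.1)).prod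
      = (L.map (fun p => r p.1)).prod := by
    intro L
    simp [FreeGroup.invRev, Function.comp_def, List.map_reverse, List.prod_reverse]
  have hne : n.toWord ≠ [] := fun h => hn1 (FreeGroup.toWord_eq_nil_iff.1 h)
  choose s hs' using fun g : FreeGroup (Fin d) =>
    exists_letter hd g.toWord n.toWord FreeGroup.isReduced_toWord FreeGroup.isReduced_toWord hne
  let φ : FreeGroup (Fin d) → N := fun g =>
    ⟨(FreeGroup.mk (g.toWord ++ [s g])) * n * (FreeGroup.mk (g.toWord ++ [s g]))⁻¹,
      hNn.conj_mem n hnN _⟩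
  have hφ : ∀ g, (φ g : FreeGroup (Fin d)).toWord =
      (g.toWord ++ [s g]) ++ n.toWord ++ FreeGroup.invRev (g.toWord ++ [s g]) := by
    intro g
    have : (φ g : FreeGroup (Fin d)) = FreeGroup.mk
        ((g.toWord ++ [s g]) ++ n.toWord ++ FreeGroup.invRev (g.toWord ++ [s g])) := by
      change FreeGroup.mk _ * n * (FreeGroup.mk _)⁻¹ = _
      rw [FreeGroup.inv_mk]
      conv_lhs => rw [← FreeGroup.mk_toWord (x := n)]
      rw [FreeGroup.mul_mk, FreeGroup.mul_mk]
    rw [this, FreeGroup.toWord_mk, (hs' g).reduce_eq]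
  have hinj : Function.Injective φ := by
    intro g h hgh
    have e : (φ g : FreeGroup (Fin d)).toWord = (φ h : FreeGroup (Fin d)).toWord := by rw [hgh]
    rw [hφ, hφ] at e
    have hl := congrArg List.length e
    simp only [List.length_append, FreeGroup.invRev_length, List.length_singleton] at hl
    simp only [List.append_assoc] at e
    exact FreeGroup.toWord_injective (List.append_inj_left e (by omega))
  have hP : 0 < ∏ i, r i := Finset.prod_pos fun i _ => (hr i).1
  have hPle : ∀ i, ∏ j, r j ≤ r i := by
    intro i
    rw [← Finset.mul_prod_erase _ _ (Finset.mem_univ i)]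
    exact mul_le_of_le_one_right (hr i).1.le
      (Finset.prod_le_one (fun j _ => (hr j).1.le) (fun j _ => (hr j).2.le))
  have hcn : 0 < cWeight r n := hpos _
  set K : ℝ := (∏ i, r i) ^ 2 * cWeight r n with hK
  have hKpos : 0 < K := by positivity
  have hbound : ∀ g, K * cWeight r g ^ 2 ≤ cWeight r (φ g) := by
    intro g
    have e : cWeight r (φ g) = cWeight r g ^ 2 * (r (s g).1 ^ 2 * cWeight r n) := by
      unfold cWeight
      rw [hφ]
      simp only [List.map_append, List.prod_append, hinv]
      simp
      ring
    rw [e, mul_comm, hK]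
    have := hPle (s g).1
    gcongr
  have hF : Summable (fun g : FreeGroup (Fin d) => cWeight r g ^ (2 * t)) := by
    refine Summable.of_nonneg_of_le (fun g => Real.rpow_nonneg (hpos _).le _) (fun g => ?_)
      ((hs.comp_injective hinj).mul_left ((K ^ t)⁻¹))
    have h0 : 0 < cWeight r g := hpos _
    have h1 := Real.rpow_le_rpow (by positivity) (hbound g) ht
    rw [Real.mul_rpow hKpos.le (by positivity), ← Real.rpow_natCast, ← Real.rpow_mul h0.le] at h1
    rw [inv_mul_eq_div, le_div_iff₀ (by positivity), mul_comm]
    exact_mod_cast h1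
  exact hF.comp_injective Subtype.val_injective

/-- For a symmetric linear GDMS associated to `F_d` (`d ≥ 2`) and every non-trivial normal
subgroup `N` of `F_d`, the exponent of convergence satisfies `δ(N,Φ) ≥ δ(F_d,Φ)/2`. -/
theorem stmt7 {d : ℕ} (hd : 2 ≤ d) (r : Fin d → ℝ) (hr : ∀ i, 0 < r i ∧ r i < 1)
    (N : Subgroup (FreeGroup (Fin d))) [N.Normal] (hN : N ≠ ⊥) :
    expConv r (⊤ : Subgroup (FreeGroup (Fin d))) / 2 ≤ expConv r N := by
  unfold expConv
  rcases Set.eq_empty_or_nonempty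
    {t : ℝ | 0 ≤ t ∧ Summable (fun h : N => cWeight r (h : FreeGroup (Fin d)) ^ t)} with h | h
  · have h2 : {t : ℝ | 0 ≤ t ∧ Summable (fun h : (⊤ : Subgroup (FreeGroup (Fin d))) =>
        cWeight r (h : FreeGroup (Fin d)) ^ t)} = ∅ := by
      rw [Set.eq_empty_iff_forall_notMem] at h ⊢
      rintro t ⟨ht, hs⟩
      refine h t ⟨ht, ?_⟩
      have hi : Function.Injective (fun x : N =>
          (⟨x.1, Subgroup.mem_top _⟩ : (⊤ : Subgroup (FreeGroup (Fin d))))) := by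
        intro x y hxy
        simp only [Subtype.mk.injEq] at hxy
        exact Subtype.ext hxy
      have h3 := hs.comp_injective hi
      simp only [Function.comp_def] at h3
      exact h3
    rw [h, h2]
    simp
  · apply le_csInf h
    rintro t ⟨ht, hs⟩
    rw [div_le_iff₀ (by norm_num), mul_comm]
    exact csInf_le ⟨0, fun x hx => hx.1⟩ ⟨by positivity, summable_top hd r hr N hN t ht hs⟩
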